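/- Let μ be a measure of the form dμ = w(x,y) dx dy on ℝ² with biorthogonal polynomials p_i, q_j and constants h_i² > 0. Then the average of the characteristic polynomial of the eigenvalue ensemble equals p_n: that is, (1/Z̃_n) ∫_{ℝ^{2n}} ∏_{m=1}^n (x − λ_m) · ∏_{i=1}^n w(λ_i, μ_i) · Δ(λ) Δ(μ) det(e stands omitted — with the joint density proportional to ∏ w(λ_i,μ_i) replaced by the determinantal density Δ(λ)Δ(μ) det(K(λ_i,μ_j)) — equals p_n(x). Concretely: if the joint density of (λ₁,…,λ_n, μ₁,…,μ_n) on ℝ^{2n} is (1/Z̃_n) Δ(λ) Δ(μ) det(ω(λ_i, μ_j))_{i,j=1}^n where ω(x,y) = e^{-V(x)-W(y)+τxy}, then E[∏_{m=1}^n (x − λ_m)] = p_n(x), the n-th monic biorthogonal polynomial for ω. -/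

import Mathlib

open MeasureTheory Polynomial

/-- Even degree, positive leading coefficient: bounded below. -/
lemma aux_bddBelow (P : Polynomial ℝ) (he : Even P.natDegree) (hd : 0 < P.natDegree)
    (hl : 0 < P.leadingCoeff) : ∃ C : ℝ, ∀ x, C ≤ P.eval x := by
  have h1 : Filter.Tendsto (fun x => P.eval x) Filter.atTop Filter.atTop :=
    P.tendsto_atTop_of_leadingCoeff_nonneg (natDegree_pos_iff_degree_pos.mp hd) hl.le
  have hnd : (P.comp (-X)).natDegree = P.natDegree := by
    rw [natDegree_comp, natDegree_neg, natDegree_X, mul_one]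
  have h2' : Filter.Tendsto (fun x => (P.comp (-X)).eval x) Filter.atTop Filter.atTop := by
    apply tendsto_atTop_of_leadingCoeff_nonneg
    · rw [← natDegree_pos_iff_degree_pos, hnd]; exact hd
    · rw [leadingCoeff_comp (by simp)]
      simp [he.neg_one_pow, hl.le]
  have h2 : Filter.Tendsto (fun x => P.eval x) Filter.atBot Filter.atTop := by
    have := h2'.comp Filter.tendsto_neg_atBot_atTop
    refine this.congr fun x => ?_
    simp [eval_comp]
  have h3 : Filter.Tendsto (fun x => P.eval x) (Filter.cocompact ℝ) Filter.atTop := by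
    rw [cocompact_eq_atBot_atTop]
    exact h2.sup h1
  obtain ⟨x, hx⟩ := P.continuous.exists_forall_le h3
  exact ⟨_, hx⟩

lemma aux_quad (P : Polynomial ℝ) (he : Even P.natDegree) (hd : 0 < P.natDegree)
    (hl : 0 < P.leadingCoeff) (K : ℝ) (hK : 2 < P.natDegree ∨ K < P.leadingCoeff) :
    ∃ C : ℝ, ∀ x, K * x ^ 2 + C ≤ P.eval x := by
  have h2 : 2 ≤ P.natDegree := by
    obtain ⟨k, hk⟩ := he; omega
  have key : (P - C K * X ^ 2).natDegree = P.natDegree ∧ 0 < (P - C K * X ^ 2).leadingCoeff := by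
    rcases lt_or_eq_of_le h2 with h | h
    · have hn : (C K * X ^ 2 : ℝ[X]).natDegree < P.natDegree :=
        (natDegree_C_mul_X_pow_le K 2).trans_lt h
      refine ⟨natDegree_sub_eq_left_of_natDegree_lt hn, ?_⟩
      rw [leadingCoeff_sub_of_degree_lt (degree_lt_degree hn)]
      exact hl
    · have hK' : K < P.coeff 2 := by
        rcases hK with hK | hK
        · omega
        · rwa [leadingCoeff, ← h] at hK
      have hc : (P - C K * X ^ 2).coeff 2 = P.coeff 2 - K := by simp
      have hnd : (P - C K * X ^ 2).natDegree = 2 := by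
        apply le_antisymm
        · apply (natDegree_sub_le _ _).trans
          exact max_le h.ge (natDegree_C_mul_X_pow_le K 2)
        · apply le_natDegree_of_ne_zero
          rw [hc]; linarith
      refine ⟨hnd.trans h, ?_⟩
      rw [leadingCoeff, hnd, hc]; linarith
  obtain ⟨c, hc⟩ := aux_bddBelow (P - C K * X ^ 2) (key.1 ▸ he) (key.1 ▸ hd) key.2
  refine ⟨c, fun x => ?_⟩
  have := hc x
  simp at this
  linarith

lemma aux_comb (V W : Polynomial ℝ) (τ A B cV cW : ℝ) (hA : 0 < A) (hB : 0 < B)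
    (hAB : τ ^ 2 < 4 * A * B)
    (hV : ∀ x, A * x ^ 2 + cV ≤ V.eval x) (hW : ∀ x, B * x ^ 2 + cW ≤ W.eval x) :
    ∃ ε > 0, ∃ C, ∀ x y, -V.eval x - W.eval y + τ * x * y ≤ C - ε * x ^ 2 - ε * y ^ 2 := by
  have hs : 0 < A + B := by linarith
  obtain ⟨ε, hε⟩ : ∃ ε, ε = (4 * A * B - τ ^ 2) / (4 * (A + B)) := ⟨_, rfl⟩
  have hε' : ε * (4 * (A + B)) = 4 * A * B - τ ^ 2 := by
    rw [hε]; field_simp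
  have hpos : 0 < ε := by rw [hε]; apply div_pos <;> linarith
  have hAe : 0 < A - ε := by
    have : ε * (4 * (A + B)) < A * (4 * (A + B)) := by nlinarith [sq_nonneg τ, mul_pos hA hA]
    have := lt_of_mul_lt_mul_right this (by linarith)
    linarith
  refine ⟨ε, hpos, -cV - cW, fun x y => ?_⟩
  have h1 := hV x
  have h2 := hW y
  have h3 : 0 ≤ (A - ε) * x ^ 2 + (B - ε) * y ^ 2 - τ * x * y := by
    have : 0 ≤ (A - ε) * ((A - ε) * x ^ 2 + (B - ε) * y ^ 2 - τ * x * y) := by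
      have e : (A - ε) * ((A - ε) * x ^ 2 + (B - ε) * y ^ 2 - τ * x * y)
        = ((A - ε) * x - τ * y / 2) ^ 2 + ((A - ε) * (B - ε) - τ ^ 2 / 4) * y ^ 2 := by ring
      rw [e]
      have : 0 ≤ (A - ε) * (B - ε) - τ ^ 2 / 4 := by nlinarith [sq_nonneg ε]
      positivity
    exact nonneg_of_mul_nonneg_right this hAe
  nlinarith

lemma aux_not_int (a b c : ℝ) (ha : 0 ≤ a) :
    ¬ Integrable (fun x : ℝ => Real.exp (a * x ^ 2 + b * x + c)) := by
  have main : ∀ b : ℝ, 0 ≤ b → ¬ Integrable (fun x : ℝ => Real.exp (a * x ^ 2 + b * x + c)) := by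
    intro b hb h
    have h2 : IntegrableOn (fun x : ℝ => Real.exp c) (Set.Ioi 0) := by
      refine Integrable.mono' h.integrableOn (by fun_prop) ?_
      filter_upwards [ae_restrict_mem measurableSet_Ioi] with x hx
      have hx : 0 < x := hx
      rw [Real.norm_eq_abs, abs_of_pos (Real.exp_pos _)]
      apply Real.exp_le_exp.mpr
      have : 0 ≤ a * x ^ 2 + b * x := by positivity
      linarith
    rw [integrableOn_const_iff] at h2
    simp [(Real.exp_pos c).ne'] at h2
  rcases le_total 0 b with hb | hb
  · exact main b hb
  · intro h
    apply main (-b) (by linarith)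
    refine h.comp_neg.congr (Filter.Eventually.of_forall fun x => ?_)
    simp

lemma aux_bound (V W : Polynomial ℝ) (τ : ℝ)
    (hVe : Even V.natDegree) (hVd : 0 < V.natDegree) (hVl : 0 < V.leadingCoeff)
    (hWe : Even W.natDegree) (hWd : 0 < W.natDegree) (hWl : 0 < W.leadingCoeff)
    (hint : (∫ x : ℝ, ∫ y : ℝ, Real.exp (-V.eval x - W.eval y + τ * x * y)) ≠ 0) :
    ∃ ε > 0, ∃ C, ∀ x y, -V.eval x - W.eval y + τ * x * y ≤ C - ε * x ^ 2 - ε * y ^ 2 := by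
  have hV2 : 2 ≤ V.natDegree := by
    obtain ⟨k, hk⟩ := hVe; omega
  have hW2 : 2 ≤ W.natDegree := by
    obtain ⟨k, hk⟩ := hWe; omega
  rcases lt_or_eq_of_le hV2 with hV | hV
  · have hB : 0 < W.leadingCoeff / 2 := by linarith
    obtain ⟨cW, hcW⟩ := aux_quad W hWe hWd hWl (W.leadingCoeff / 2) (Or.inr (by linarith))
    obtain ⟨cV, hcV⟩ := aux_quad V hVe hVd hVl ((τ ^ 2 + 1) / (W.leadingCoeff / 2)) (Or.inl hV)
    refine aux_comb V W τ _ _ cV cW (by positivity) hB ?_ hcV hcW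
    have : 4 * ((τ ^ 2 + 1) / (W.leadingCoeff / 2)) * (W.leadingCoeff / 2) = 4 * (τ ^ 2 + 1) := by
      field_simp
    rw [this]; nlinarith [sq_nonneg τ]
  rcases lt_or_eq_of_le hW2 with hW | hW
  · have hB : 0 < V.leadingCoeff / 2 := by linarith
    obtain ⟨cV, hcV⟩ := aux_quad V hVe hVd hVl (V.leadingCoeff / 2) (Or.inr (by linarith))
    obtain ⟨cW, hcW⟩ := aux_quad W hWe hWd hWl ((τ ^ 2 + 1) / (V.leadingCoeff / 2)) (Or.inl hW)
    refine aux_comb V W τ _ _ cV cW hB (by positivity) ?_ hcV hcW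
    have : 4 * (V.leadingCoeff / 2) * ((τ ^ 2 + 1) / (V.leadingCoeff / 2)) = 4 * (τ ^ 2 + 1) := by
      field_simp
    rw [this]; nlinarith [sq_nonneg τ]
  obtain ⟨a, ha⟩ : ∃ a, a = V.leadingCoeff := ⟨_, rfl⟩
  obtain ⟨b, hb⟩ : ∃ b, b = W.leadingCoeff := ⟨_, rfl⟩
  rw [← ha] at hVl
  rw [← hb] at hWl
  have hVx : ∀ x, V.eval x = a * x ^ 2 + V.coeff 1 * x + V.coeff 0 := by
    intro x
    rw [eval_eq_sum_range, ← hV, ha, leadingCoeff, ← hV]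
    simp [Finset.sum_range_succ]; ring
  have hWx : ∀ x, W.eval x = b * x ^ 2 + W.coeff 1 * x + W.coeff 0 := by
    intro x
    rw [eval_eq_sum_range, ← hW, hb, leadingCoeff, ← hW]
    simp [Finset.sum_range_succ]; ring
  by_cases hab : τ ^ 2 < 4 * a * b
  · have hs : 0 < a + b := by linarith
    obtain ⟨ε, hε⟩ : ∃ ε, ε = (4 * a * b - τ ^ 2) / (8 * (a + b)) := ⟨_, rfl⟩
    have hε' : ε * (8 * (a + b)) = 4 * a * b - τ ^ 2 := by
      rw [hε]; field_simp
    have hpos : 0 < ε := by rw [hε]; apply div_pos <;> linarith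
    have hAe : 0 < a - ε := by
      have : ε * (8 * (a + b)) < a * (8 * (a + b)) := by nlinarith [sq_nonneg τ, mul_pos hVl hWl]
      have := lt_of_mul_lt_mul_right this (by linarith)
      linarith
    have hBe : 0 < b - ε := by
      have : ε * (8 * (a + b)) < b * (8 * (a + b)) := by nlinarith [sq_nonneg τ, mul_pos hVl hWl]
      have := lt_of_mul_lt_mul_right this (by linarith)
      linarith
    obtain ⟨cV, hcV⟩ := aux_quad V hVe hVd (ha ▸ hVl) (a - ε) (Or.inr (by linarith))
    obtain ⟨cW, hcW⟩ := aux_quad W hWe hWd (hb ▸ hWl) (b - ε) (Or.inr (by linarith))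
    refine aux_comb V W τ _ _ cV cW hAe hBe ?_ hcV hcW
    nlinarith [sq_nonneg ε]
  · exfalso
    push Not at hab
    have hG : ∀ x : ℝ, (∫ y : ℝ, Real.exp (-V.eval x - W.eval y + τ * x * y))
        = Real.exp ((τ ^ 2 / (4 * b) - a) * x ^ 2 + (-V.coeff 1 - W.coeff 1 * τ / (2 * b)) * x
            + (-V.coeff 0)) *
          ∫ y : ℝ, Real.exp (-W.eval y) := by
      intro x
      rw [← integral_add_right_eq_self _ (τ * x / (2 * b)), ← integral_const_mul]
      congr 1
      ext y
      rw [← Real.exp_add]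
      congr 1
      rw [hVx, hWx, hWx]
      field_simp
      ring
    simp_rw [hG] at hint
    rw [integral_mul_const] at hint
    apply left_ne_zero_of_mul hint
    apply integral_undef
    apply aux_not_int
    rw [sub_nonneg, le_div_iff₀ (by linarith)]
    linarith

/-- Integrability of polynomial times Gaussian. -/
lemma aux_poly_gauss (f : Polynomial ℝ) (ε : ℝ) (hε : 0 < ε) :
    Integrable (fun x : ℝ => f.eval x * Real.exp (-ε * x ^ 2)) := by
  induction f using Polynomial.induction_on' with
  | add p q hp hq =>
    refine (hp.add hq).congr (Filter.Eventually.of_forall fun x => ?_)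
    simp [add_mul]
  | monomial k a =>
    have h := integrable_rpow_mul_exp_neg_mul_sq hε (s := k) (by
      have : (0 : ℝ) ≤ k := k.cast_nonneg
      linarith)
    simp only [Real.rpow_natCast] at h
    simpa [mul_assoc] using h.const_mul a

lemma aux_int (V W : Polynomial ℝ) (τ ε C : ℝ) (hε : 0 < ε)
    (hb : ∀ x y, -V.eval x - W.eval y + τ * x * y ≤ C - ε * x ^ 2 - ε * y ^ 2)
    (ω : ℝ → ℝ → ℝ)
    (hω : ∀ x y, ω x y = Real.exp (-V.eval x - W.eval y + τ * x * y)) (f g : Polynomial ℝ) :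
    (∀ x a, Integrable (fun y => a * g.eval y * ω x y)) ∧
      Integrable (fun x => ∫ y, f.eval x * g.eval y * ω x y) := by
  have hle : ∀ x y, |ω x y| ≤ Real.exp C * Real.exp (-ε * x ^ 2) * Real.exp (-ε * y ^ 2) := by
    intro x y
    rw [hω, abs_of_pos (Real.exp_pos _), ← Real.exp_add, ← Real.exp_add]
    apply Real.exp_le_exp.mpr
    have := hb x y
    linarith
  have hc : Continuous (Function.uncurry ω) := by
    have : Function.uncurry ω
        = fun z : ℝ × ℝ => Real.exp (-V.eval z.1 - W.eval z.2 + τ * z.1 * z.2) := by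
      ext z; exact hω _ _
    rw [this]
    fun_prop
  have hcx : ∀ x, Continuous (ω x) := fun x => hc.comp (Continuous.prodMk_right x)
  constructor
  · intro x a
    refine Integrable.mono'
      (((aux_poly_gauss g ε hε).norm).const_mul (|a| * (Real.exp C * Real.exp (-ε * x ^ 2)))) ?_ ?_
    · have := hcx x
      apply Continuous.aestronglyMeasurable
      fun_prop
    · refine Filter.Eventually.of_forall fun y => ?_
      simp only [Real.norm_eq_abs, abs_mul, Real.abs_exp]
      calc |a| * |g.eval y| * |ω x y|
          ≤ |a| * |g.eval y| * (Real.exp C * Real.exp (-ε * x ^ 2) * Real.exp (-ε * y ^ 2)) := by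
            gcongr; exact hle x y
        _ = _ := by ring
  · have hI : Integrable (fun z : ℝ × ℝ => f.eval z.1 * g.eval z.2 * ω z.1 z.2)
        (volume.prod volume) := by
      refine Integrable.mono'
        ((((aux_poly_gauss f ε hε).mul_prod (aux_poly_gauss g ε hε)).norm).const_mul
          (Real.exp C)) ?_ ?_
      · have hc' : Continuous (fun z : ℝ × ℝ => ω z.1 z.2) := hc
        apply Continuous.aestronglyMeasurable
        fun_prop
      · refine Filter.Eventually.of_forall fun z => ?_
        simp only [Real.norm_eq_abs, abs_mul, Real.abs_exp]
        calc |f.eval z.1| * |g.eval z.2| * |ω z.1 z.2|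
            ≤ |f.eval z.1| * |g.eval z.2| *
              (Real.exp C * Real.exp (-ε * z.1 ^ 2) * Real.exp (-ε * z.2 ^ 2)) := by
              gcongr; exact hle _ _
          _ = _ := by ring
    exact hI.integral_prod_left

/-- Expansion of the product of three determinants. -/
lemma aux_expand {n : ℕ} (f g : Fin n → Polynomial ℝ) (ω : ℝ → ℝ → ℝ) (l m : Fin n → ℝ) :
    (Matrix.of fun i k => (f k).eval (l i)).det * (Matrix.of fun i k => (g k).eval (m i)).det *
        (Matrix.of fun i j : Fin n => ω (l i) (m j)).det
    = ∑ s : Equiv.Perm (Fin n) × Equiv.Perm (Fin n) × Equiv.Perm (Fin n),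
        (((Equiv.Perm.sign s.1 : ℤ) : ℝ) * ((Equiv.Perm.sign s.2.1 : ℤ) : ℝ)
          * ((Equiv.Perm.sign s.2.2 : ℤ) : ℝ)) *
        ∏ j, ((f (s.1 (s.2.2.symm j))).eval (l (s.2.2.symm j)) * (g (s.2.1 j)).eval (m j)
          * ω (l (s.2.2.symm j)) (m j)) := by
  rw [← Matrix.det_transpose, ← Matrix.det_transpose (Matrix.of fun i k => (g k).eval (m i)),
    ← Matrix.det_transpose (Matrix.of fun i j : Fin n => ω (l i) (m j))]
  rw [Matrix.det_apply', Matrix.det_apply', Matrix.det_apply']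
  rw [Fintype.sum_prod_type]
  simp_rw [Fintype.sum_prod_type]
  rw [Finset.sum_mul_sum, Finset.sum_mul]
  refine Finset.sum_congr rfl fun σ _ => ?_
  rw [Finset.sum_mul]
  refine Finset.sum_congr rfl fun ρ _ => ?_
  rw [Finset.mul_sum]
  refine Finset.sum_congr rfl fun π _ => ?_
  rw [Finset.prod_mul_distrib, Finset.prod_mul_distrib,
    Equiv.prod_comp π.symm (fun i => (f (σ i)).eval (l i)),
    ← Equiv.prod_comp π (fun j => ω (l (π.symm j)) (m j))]
  simp only [Matrix.transpose_apply, Matrix.of_apply, Equiv.symm_apply_apply]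
  ring

lemma aux_core {n : ℕ} (ω : ℝ → ℝ → ℝ)
    (hω : ∀ f g : Polynomial ℝ, (∀ x a, Integrable (fun y => a * g.eval y * ω x y)) ∧
      Integrable (fun x => ∫ y, f.eval x * g.eval y * ω x y)) (f g : Fin n → Polynomial ℝ) :
    (∀ l : Fin n → ℝ, Integrable (fun m : Fin n → ℝ =>
      (Matrix.of fun i k => (f k).eval (l i)).det * (Matrix.of fun i k => (g k).eval (m i)).det *
        (Matrix.of fun i j : Fin n => ω (l i) (m j)).det)) ∧
    Integrable (fun l : Fin n → ℝ => ∫ m : Fin n → ℝ,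
      (Matrix.of fun i k => (f k).eval (l i)).det * (Matrix.of fun i k => (g k).eval (m i)).det *
        (Matrix.of fun i j : Fin n => ω (l i) (m j)).det) ∧
    ((∃ k, ∀ j, (∫ x, ∫ y, (f k).eval x * (g j).eval y * ω x y) = 0) →
      (∫ l : Fin n → ℝ, ∫ m : Fin n → ℝ,
      (Matrix.of fun i k => (f k).eval (l i)).det * (Matrix.of fun i k => (g k).eval (m i)).det *
        (Matrix.of fun i j : Fin n => ω (l i) (m j)).det) = 0) := by
  simp_rw [aux_expand]
  have hin : ∀ (l : Fin n → ℝ)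
      (s : Equiv.Perm (Fin n) × Equiv.Perm (Fin n) × Equiv.Perm (Fin n)),
      Integrable (fun m : Fin n → ℝ => (((Equiv.Perm.sign s.1 : ℤ) : ℝ) *
        ((Equiv.Perm.sign s.2.1 : ℤ) : ℝ) * ((Equiv.Perm.sign s.2.2 : ℤ) : ℝ)) *
        ∏ j, ((f (s.1 (s.2.2.symm j))).eval (l (s.2.2.symm j)) * (g (s.2.1 j)).eval (m j)
          * ω (l (s.2.2.symm j)) (m j))) := by
    intro l s
    apply Integrable.const_mul
    exact Integrable.fintype_prod (f := fun j y => (f (s.1 (s.2.2.symm j))).eval (l (s.2.2.symm j))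
      * (g (s.2.1 j)).eval y * ω (l (s.2.2.symm j)) y) fun j => (hω 1 _).1 _ _
  have hval : ∀ l : Fin n → ℝ, (∫ m : Fin n → ℝ,
      ∑ s : Equiv.Perm (Fin n) × Equiv.Perm (Fin n) × Equiv.Perm (Fin n),
        (((Equiv.Perm.sign s.1 : ℤ) : ℝ) * ((Equiv.Perm.sign s.2.1 : ℤ) : ℝ)
          * ((Equiv.Perm.sign s.2.2 : ℤ) : ℝ)) *
        ∏ j, ((f (s.1 (s.2.2.symm j))).eval (l (s.2.2.symm j)) * (g (s.2.1 j)).eval (m j)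
          * ω (l (s.2.2.symm j)) (m j)))
      = ∑ s : Equiv.Perm (Fin n) × Equiv.Perm (Fin n) × Equiv.Perm (Fin n),
        (((Equiv.Perm.sign s.1 : ℤ) : ℝ) * ((Equiv.Perm.sign s.2.1 : ℤ) : ℝ)
          * ((Equiv.Perm.sign s.2.2 : ℤ) : ℝ)) *
        ∏ i, ∫ y, (f (s.1 i)).eval (l i) * (g (s.2.1 (s.2.2 i))).eval y * ω (l i) y := by
    intro l
    rw [integral_finsetSum _ fun s _ => hin l s]
    refine Finset.sum_congr rfl fun s _ => ?_
    rw [integral_const_mul, integral_fintype_prod_volume_eq_prod (fun j y =>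
      (f (s.1 (s.2.2.symm j))).eval (l (s.2.2.symm j))
      * (g (s.2.1 j)).eval y * ω (l (s.2.2.symm j)) y)]
    congr 1
    rw [← Equiv.prod_comp s.2.2]
    simp only [Equiv.symm_apply_apply]
  have hout : ∀ (s : Equiv.Perm (Fin n) × Equiv.Perm (Fin n) × Equiv.Perm (Fin n)),
      Integrable (fun l : Fin n → ℝ => (((Equiv.Perm.sign s.1 : ℤ) : ℝ) *
        ((Equiv.Perm.sign s.2.1 : ℤ) : ℝ) * ((Equiv.Perm.sign s.2.2 : ℤ) : ℝ)) *
        ∏ i, ∫ y, (f (s.1 i)).eval (l i) * (g (s.2.1 (s.2.2 i))).eval y * ω (l i) y) := by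
    intro s
    apply Integrable.const_mul
    exact Integrable.fintype_prod (f := fun i x =>
      ∫ y, (f (s.1 i)).eval x * (g (s.2.1 (s.2.2 i))).eval y * ω x y) fun j => (hω _ _).2
  simp_rw [hval]
  refine ⟨fun l => integrable_finsetSum _ fun s _ => hin l s,
    integrable_finsetSum _ fun s _ => hout s, ?_⟩
  rintro ⟨k, hk⟩
  rw [integral_finsetSum _ fun s _ => hout s]
  refine Finset.sum_eq_zero fun s _ => ?_
  rw [integral_const_mul, integral_fintype_prod_volume_eq_prod (fun i x =>
      ∫ y, (f (s.1 i)).eval x * (g (s.2.1 (s.2.2 i))).eval y * ω x y)]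
  rw [Finset.prod_eq_zero (Finset.mem_univ (s.1.symm k)), mul_zero]
  rw [Equiv.apply_symm_apply]
  exact hk _

lemma aux_det (p : ℕ → Polynomial ℝ) (hpm : ∀ i, (p i).Monic) (hpd : ∀ i, (p i).natDegree = i)
    (n : ℕ) (x : ℝ) (l : Fin n → ℝ) :
    (∏ k : Fin n, (x - l k)) * (Matrix.vandermonde l).det
    = ∑ j : Fin (n + 1), ((-1) ^ n * (-1) ^ (j : ℕ) * (p j).eval x) *
        (Matrix.of fun i k : Fin n => (p (j.succAbove k)).eval (l i)).det := by
  have h1 : (Matrix.vandermonde (Fin.cons x l : Fin (n + 1) → ℝ)).det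
      = (-1) ^ n * ((∏ k : Fin n, (x - l k)) * (Matrix.vandermonde l).det) := by
    rw [Matrix.det_vandermonde, Matrix.det_vandermonde, Fin.prod_univ_succ]
    simp only [Fin.prod_Ioi_zero, Fin.cons_zero, Fin.cons_succ, Fin.prod_Ioi_succ]
    rw [← mul_assoc]
    congr 1
    have : ((-1 : ℝ)) ^ n = ∏ _k : Fin n, (-1 : ℝ) := by simp
    rw [this, ← Finset.prod_mul_distrib]
    exact Finset.prod_congr rfl fun _ _ => by ring
  have h2 := Matrix.det_eval_matrixOfPolynomials_eq_det_vandermonde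
    (Fin.cons x l : Fin (n + 1) → ℝ) (fun j => p j) (fun i => hpd i) (fun i => hpm i)
  rw [h1, Matrix.det_succ_row_zero] at h2
  have h3 : ((-1 : ℝ) ^ n) * (-1) ^ n = 1 := by rw [← mul_pow]; simp
  calc _ = (-1 : ℝ) ^ n * ((-1) ^ n *
        ((∏ k : Fin n, (x - l k)) * (Matrix.vandermonde l).det)) := by
        rw [← mul_assoc, h3, one_mul]
    _ = _ := by
        rw [h2, Finset.mul_sum]
        refine Finset.sum_congr rfl fun j _ => ?_
        have : ((Matrix.of fun (i j : Fin (n + 1)) =>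
            eval ((Fin.cons x l : Fin (n + 1) → ℝ) i) (p j)).submatrix Fin.succ j.succAbove)
            = (Matrix.of fun i k : Fin n => (p (j.succAbove k)).eval (l i)) := by
          ext i k
          simp
        rw [this]
        simp only [Matrix.of_apply, Fin.cons_zero]
        ring

/-- Theorem 1 of the paper: the average characteristic polynomial of `M₁` in the two-matrix
model equals the monic biorthogonal polynomial `pₙ`. -/
theorem stmt_7 (V W : Polynomial ℝ) (τ : ℝ)
    (hVe : Even V.natDegree) (hVd : 0 < V.natDegree) (hVl : 0 < V.leadingCoeff)
    (hWe : Even W.natDegree) (hWd : 0 < W.natDegree) (hWl : 0 < W.leadingCoeff)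
    (ω : ℝ → ℝ → ℝ)
    (hω : ∀ x y, ω x y = Real.exp (-V.eval x - W.eval y + τ * x * y))
    (p q : ℕ → Polynomial ℝ) (hsq : ℕ → ℝ)
    (hpm : ∀ i, (p i).Monic) (hpd : ∀ i, (p i).natDegree = i)
    (hqm : ∀ j, (q j).Monic) (hqd : ∀ j, (q j).natDegree = j)
    (hh : ∀ i, 0 < hsq i)
    (hbi : ∀ i j, (∫ x : ℝ, ∫ y : ℝ, (p i).eval x * (q j).eval y * ω x y)
      = if i = j then hsq i else 0)
    (n : ℕ) (Z : ℝ)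
    (hZ : Z = ∫ l : Fin n → ℝ, ∫ m : Fin n → ℝ,
      (Matrix.vandermonde l).det * (Matrix.vandermonde m).det *
        (Matrix.of fun i j : Fin n => ω (l i) (m j)).det)
    (hZ0 : Z ≠ 0) :
    ∀ x : ℝ,
      (∫ l : Fin n → ℝ, ∫ m : Fin n → ℝ,
        (∏ k : Fin n, (x - l k)) *
          ((Matrix.vandermonde l).det * (Matrix.vandermonde m).det *
            (Matrix.of fun i j : Fin n => ω (l i) (m j)).det)) / Z
      = (p n).eval x := by
  intro x
  have hω0 : (∫ x : ℝ, ∫ y : ℝ, Real.exp (-V.eval x - W.eval y + τ * x * y)) ≠ 0 := by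
    have h := hbi 0 0
    have hp0 : p 0 = 1 := (hpm 0).natDegree_eq_zero.mp (hpd 0)
    have hq0 : q 0 = 1 := (hqm 0).natDegree_eq_zero.mp (hqd 0)
    simp only [hp0, hq0, hω, eval_one, one_mul, if_true] at h
    rw [h]
    exact (hh 0).ne'
  obtain ⟨ε, hε, C, hb⟩ := aux_bound V W τ hVe hVd hVl hWe hWd hWl hω0
  have hI := aux_int V W τ ε C hε hb ω hω
  have hm : ∀ m : Fin n → ℝ, (Matrix.vandermonde m).det
      = (Matrix.of fun i k : Fin n => (q k).eval (m i)).det := fun m =>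
    Matrix.det_eval_matrixOfPolynomials_eq_det_vandermonde m (fun j : Fin n => q j)
      (fun i => hqd i) (fun i => hqm i)
  have core := fun j : Fin (n + 1) => aux_core ω hI (fun k : Fin n => p (j.succAbove k))
    (fun k : Fin n => q k)
  have hZ' : Z = ∫ l : Fin n → ℝ, ∫ m : Fin n → ℝ,
      (Matrix.of fun i k : Fin n => (p ((Fin.last n).succAbove k)).eval (l i)).det *
        (Matrix.of fun i k : Fin n => (q k).eval (m i)).det *
        (Matrix.of fun i j : Fin n => ω (l i) (m j)).det := by
    rw [hZ]
    congr 1; ext l; congr 1; ext m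
    rw [hm m, Matrix.det_eval_matrixOfPolynomials_eq_det_vandermonde l (fun j : Fin n => p j)
      (fun i => hpd i) (fun i => hpm i)]
    simp only [Fin.succAbove_last, Fin.val_castSucc]
  have hexp : ∀ l m : Fin n → ℝ, (∏ k : Fin n, (x - l k)) *
          ((Matrix.vandermonde l).det * (Matrix.vandermonde m).det *
            (Matrix.of fun i j : Fin n => ω (l i) (m j)).det)
      = ∑ j : Fin (n + 1), ((-1) ^ n * (-1) ^ (j : ℕ) * (p j).eval x) *
        ((Matrix.of fun i k : Fin n => (p (j.succAbove k)).eval (l i)).det *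
        (Matrix.of fun i k : Fin n => (q k).eval (m i)).det *
        (Matrix.of fun i j : Fin n => ω (l i) (m j)).det) := by
    intro l m
    rw [← mul_assoc, ← mul_assoc, aux_det p hpm hpd, hm, Finset.sum_mul, Finset.sum_mul]
    exact Finset.sum_congr rfl fun j _ => by ring
  simp_rw [hexp]
  rw [div_eq_iff hZ0]
  have hinner : ∀ l : Fin n → ℝ, (∫ m : Fin n → ℝ,
      ∑ j : Fin (n + 1), ((-1) ^ n * (-1) ^ (j : ℕ) * (p j).eval x) *
        ((Matrix.of fun i k : Fin n => (p (j.succAbove k)).eval (l i)).det *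
        (Matrix.of fun i k : Fin n => (q k).eval (m i)).det *
        (Matrix.of fun i j : Fin n => ω (l i) (m j)).det))
      = ∑ j : Fin (n + 1), ((-1) ^ n * (-1) ^ (j : ℕ) * (p j).eval x) * ∫ m : Fin n → ℝ,
        ((Matrix.of fun i k : Fin n => (p (j.succAbove k)).eval (l i)).det *
        (Matrix.of fun i k : Fin n => (q k).eval (m i)).det *
        (Matrix.of fun i j : Fin n => ω (l i) (m j)).det) := by
    intro l
    rw [integral_finsetSum _ fun j _ => ((core j).1 l).const_mul _]
    simp_rw [integral_const_mul]
  simp_rw [hinner]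
  rw [integral_finsetSum _ fun j _ => (core j).2.1.const_mul _]
  simp_rw [integral_const_mul]
  rw [Finset.sum_eq_single (Fin.last n), ← hZ']
  · have h3 : ((-1 : ℝ) ^ n) * (-1) ^ n = 1 := by rw [← mul_pow]; simp
    simp only [Fin.val_last, h3, one_mul]
  · intro j _ hj
    rw [(core j).2.2, mul_zero]
    obtain ⟨k, hk⟩ := Fin.exists_succAbove_eq (Ne.symm hj)
    refine ⟨k, fun i => ?_⟩
    simp only [hk]
    rw [hbi, if_neg]
    have := i.2
    simp only [Fin.val_last]
    omega
  · simp
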